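/- Uniform boundedness of the principal-value kernel in the double smoothing estimate: for c ∈ ℝ let α(c) denote the unique real root of ξ(ξ²+1) = c. Then there exists C>0 such that for every c ∈ ℝ and every y ∈ ℝ with y ≠ 0, the iterated limit K(c,y) := lim_{ε→0⁺} lim_{R→∞} ∫_{{ξ ∈ ℝ : ε ≤ |ξ−α(c)|, |ξ| ≤ R}} e^{iyξ} (ξ²+1)/(c − ξ(ξ²+1)) dξ exists and satisfies |K(c,y)| ≤ C. -/

import Mathlib

open MeasureTheory Real Filter
open scoped ENNReal

noncomputable section

/-- Truncated principal-value oscillatory integral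
∫_{ε ≤ |ξ-a|, |ξ| ≤ R} e^{iyξ} (ξ²+1)/(c-ξ(ξ²+1)) dξ. -/
def pvInt (c y a ε R : ℝ) : ℂ :=
  ∫ ξ in {ξ : ℝ | ε ≤ |ξ - a| ∧ |ξ| ≤ R},
    Complex.exp (Complex.I * ((y * ξ : ℝ) : ℂ)) *
      (((ξ ^ 2 + 1 : ℝ) : ℂ) / ((c - ξ * (ξ ^ 2 + 1) : ℝ) : ℂ))

/-- The kernel `(ξ²+1)/(c-ξ(ξ²+1))`, with `c = a(a²+1)`, at `ξ = a + t`. -/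
def shiftedKernel (a t : ℝ) : ℝ :=
  ((a + t) ^ 2 + 1) / -(t * (t ^ 2 + 3 * a * t + 3 * a ^ 2 + 1))

/-- The derivative of `shiftedKernel a` away from `0`. -/
def shiftedKernelDeriv (a t : ℝ) : ℝ :=
  (2 * (a + t) * -(t * (t ^ 2 + 3 * a * t + 3 * a ^ 2 + 1)) -
    ((a + t) ^ 2 + 1) * -((t ^ 2 + 3 * a * t + 3 * a ^ 2 + 1) + t * (2 * t + 3 * a))) /
    (-(t * (t ^ 2 + 3 * a * t + 3 * a ^ 2 + 1))) ^ 2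

lemma le_six_mul_quadratic (a t : ℝ) :
    a ^ 2 + t ^ 2 + 1 ≤ 6 * (t ^ 2 + 3 * a * t + 3 * a ^ 2 + 1) := by
  nlinarith [sq_nonneg (5 * t + 9 * a), sq_nonneg a]

lemma quadratic_pos (a t : ℝ) : 0 < t ^ 2 + 3 * a * t + 3 * a ^ 2 + 1 := by
  nlinarith [le_six_mul_quadratic a t, sq_nonneg a, sq_nonneg t]

lemma shiftedKernel_denom_ne_zero (a : ℝ) {t : ℝ} (ht : 0 < t) :
    -(t * (t ^ 2 + 3 * a * t + 3 * a ^ 2 + 1)) ≠ 0 :=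
  neg_ne_zero.mpr (mul_pos ht (quadratic_pos a t)).ne'

lemma hasDerivAt_shiftedKernel (a : ℝ) {t : ℝ} (ht : 0 < t) :
    HasDerivAt (shiftedKernel a) (shiftedKernelDeriv a t) t := by
  have hi := hasDerivAt_id t
  have hn : HasDerivAt (fun t : ℝ => (a + t) ^ 2 + 1) (2 * (a + t)) t := by
    exact (((hi.const_add a).pow 2).add_const 1).congr_deriv (by simp)
  have hq : HasDerivAt (fun t : ℝ => t ^ 2 + 3 * a * t + 3 * a ^ 2 + 1) (2 * t + 3 * a) t := by
    exact ((((hi.pow 2).add (hi.const_mul (3 * a))).add_const (3 * a ^ 2)).add_const 1).congr_deriv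
      (by simp)
  have hd : HasDerivAt (fun t : ℝ => -(t * (t ^ 2 + 3 * a * t + 3 * a ^ 2 + 1)))
      (-((t ^ 2 + 3 * a * t + 3 * a ^ 2 + 1) + t * (2 * t + 3 * a))) t := by
    exact (hi.mul hq).neg.congr_deriv (by simp)
  exact hn.div hd (shiftedKernel_denom_ne_zero a ht)

lemma continuousOn_shiftedKernel (a : ℝ) : ContinuousOn (shiftedKernel a) (Set.Ioi 0) :=
  fun _ ht => (hasDerivAt_shiftedKernel a ht).continuousAt.continuousWithinAt

lemma continuousOn_shiftedKernelDeriv (a : ℝ) :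
    ContinuousOn (shiftedKernelDeriv a) (Set.Ioi 0) := by
  unfold shiftedKernelDeriv
  refine ContinuousOn.div (by fun_prop) (by fun_prop) fun t ht => ?_
  exact pow_ne_zero 2 (shiftedKernel_denom_ne_zero a ht)

lemma abs_shiftedKernel_le (a : ℝ) {t : ℝ} (ht : 0 < t) : |shiftedKernel a t| ≤ 300 / t := by
  have hq := quadratic_pos a t
  have h6 := le_six_mul_quadratic a t
  rw [shiftedKernel, abs_div, abs_neg, abs_of_pos (mul_pos ht hq), abs_of_pos (by positivity),
    div_le_div_iff₀ (mul_pos ht hq) ht]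
  have : (a + t) ^ 2 + 1 ≤ 300 * (t ^ 2 + 3 * a * t + 3 * a ^ 2 + 1) := by
    nlinarith [sq_nonneg (a - t)]
  nlinarith

lemma abs_shiftedKernelDeriv_le (a : ℝ) {t : ℝ} (ht : 0 < t) :
    |shiftedKernelDeriv a t| ≤ 300 / t ^ 2 := by
  have hq := quadratic_pos a t
  have h6 := le_six_mul_quadratic a t
  unfold shiftedKernelDeriv
  set q := t ^ 2 + 3 * a * t + 3 * a ^ 2 + 1 with hq_def
  have hN : |(a + t) ^ 2 + 1| ≤ 12 * q := by
    rw [abs_of_pos (by positivity)]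
    nlinarith [sq_nonneg (a - t)]
  have h1 : |2 * (a + t) * t| ≤ 18 * q := by
    rw [abs_le]
    constructor <;> nlinarith [sq_nonneg (a - t), sq_nonneg (a + t), sq_nonneg a, sq_nonneg t]
  have h2 : |t * (2 * t + 3 * a)| ≤ 21 * q := by
    rw [abs_le]
    constructor <;> nlinarith [sq_nonneg (a - t), sq_nonneg (a + t), sq_nonneg a, sq_nonneg t]
  have key : |2 * (a + t) * -(t * q) - ((a + t) ^ 2 + 1) * -(q + t * (2 * t + 3 * a))| ≤
      300 * q ^ 2 := by
    calc _ = |-(2 * (a + t) * t * q) + ((a + t) ^ 2 + 1) * (q + t * (2 * t + 3 * a))| := by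
            congr 1; ring
      _ ≤ |2 * (a + t) * t| * |q| + |(a + t) ^ 2 + 1| * (|q| + |t * (2 * t + 3 * a)|) := by
            refine (abs_add_le _ _).trans ?_
            rw [abs_neg, abs_mul _ q, abs_mul ((a + t) ^ 2 + 1)]
            gcongr
            exact abs_add_le _ _
      _ ≤ 18 * q * q + 12 * q * (q + 21 * q) := by
            rw [abs_of_pos hq]; gcongr
      _ ≤ 300 * q ^ 2 := by nlinarith
  rw [abs_div, abs_of_nonneg (sq_nonneg (-(t * q))), neg_sq,
    div_le_div_iff₀ (by positivity) (by positivity)]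
  calc _ ≤ 300 * q ^ 2 * t ^ 2 := by gcongr
    _ = _ := by ring

lemma abs_shiftedKernel_sub_le (a : ℝ) {t : ℝ} (ht : 0 < t) :
    |shiftedKernel a t - shiftedKernel (-a) t| ≤
      216 * (√(a ^ 2 + 1) / (√(a ^ 2 + 1) ^ 2 + t ^ 2)) := by
  have hq := quadratic_pos a t
  have hq' := quadratic_pos (-a) t
  have h6 := le_six_mul_quadratic a t
  have h6' := le_six_mul_quadratic (-a) t
  have heq : shiftedKernel a t - shiftedKernel (-a) t =
      -(2 * a * (3 * a ^ 2 - 1 - t ^ 2)) / ((t ^ 2 + 3 * a * t + 3 * a ^ 2 + 1) *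
        (t ^ 2 + 3 * (-a) * t + 3 * (-a) ^ 2 + 1)) := by
    unfold shiftedKernel
    rw [div_sub_div _ _ (shiftedKernel_denom_ne_zero a ht) (shiftedKernel_denom_ne_zero (-a) ht),
      div_eq_div_iff (mul_ne_zero (shiftedKernel_denom_ne_zero a ht)
        (shiftedKernel_denom_ne_zero (-a) ht)) (mul_pos hq hq').ne']
    ring
  have hb : |a| ≤ √(a ^ 2 + 1) := by
    rw [← Real.sqrt_sq_eq_abs]; exact Real.sqrt_le_sqrt (by linarith)
  rw [heq, abs_div, abs_of_pos (mul_pos hq hq'), Real.sq_sqrt (by positivity), abs_neg, abs_mul,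
    abs_mul, abs_two]
  have h3 : |3 * a ^ 2 - 1 - t ^ 2| ≤ 3 * (a ^ 2 + t ^ 2 + 1) := by
    rw [abs_le]; constructor <;> nlinarith [sq_nonneg a, sq_nonneg t]
  have hw : 0 < a ^ 2 + t ^ 2 + 1 := by positivity
  have hden : (a ^ 2 + t ^ 2 + 1) / 6 * ((a ^ 2 + t ^ 2 + 1) / 6) ≤
      (t ^ 2 + 3 * a * t + 3 * a ^ 2 + 1) * (t ^ 2 + 3 * (-a) * t + 3 * (-a) ^ 2 + 1) := by
    refine mul_le_mul (by linarith) ?_ (by positivity) hq.le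
    rw [neg_sq] at h6'
    linarith
  calc _ ≤ 2 * √(a ^ 2 + 1) * (3 * (a ^ 2 + t ^ 2 + 1)) /
          ((a ^ 2 + t ^ 2 + 1) / 6 * ((a ^ 2 + t ^ 2 + 1) / 6)) := by gcongr
    _ = _ := by
      have : a ^ 2 + 1 + t ^ 2 ≠ 0 := by positivity
      field_simp
      ring

/-- The oscillating factor `e^{iyt}`. -/
def phase (y t : ℝ) : ℂ := Complex.exp (Complex.I * ((y * t : ℝ) : ℂ))

lemma continuous_phase (y : ℝ) : Continuous (phase y) := by
  unfold phase; fun_prop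

lemma norm_phase (y t : ℝ) : ‖phase y t‖ = 1 := by
  rw [phase, mul_comm, Complex.norm_exp_ofReal_mul_I]

lemma phase_add (y s t : ℝ) : phase y (s + t) = phase y s * phase y t := by
  simp only [phase, ← Complex.exp_add]
  push_cast
  ring_nf

lemma phase_neg_right (y t : ℝ) : phase y (-t) = phase (-y) t := by
  simp [phase]

lemma norm_phase_sub_phase_neg_le (y t : ℝ) : ‖phase y t - phase (-y) t‖ ≤ 2 * |y * t| := by
  have h1 : ∀ x : ℝ, ‖Complex.exp (Complex.I * (x : ℂ)) - 1‖ ≤ |x| := fun x => by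
    simpa using Real.norm_exp_I_mul_ofReal_sub_one_le (x := x)
  calc ‖phase y t - phase (-y) t‖ = ‖(phase y t - 1) - (phase (-y) t - 1)‖ := by
        congr 1; ring
    _ ≤ |y * t| + |-y * t| := (norm_sub_le _ _).trans (add_le_add (h1 _) (h1 _))
    _ = 2 * |y * t| := by rw [neg_mul, abs_neg]; ring

lemma hasDerivAt_phase_div {y : ℝ} (hy : y ≠ 0) (t : ℝ) :
    HasDerivAt (fun t => phase y t / (Complex.I * y)) (phase y t) t := by
  have h : HasDerivAt (fun t : ℝ => Complex.I * ((y * t : ℝ) : ℂ)) (Complex.I * y) t := by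
    simpa using (((hasDerivAt_id t).const_mul y).ofReal_comp).const_mul Complex.I
  have hne : Complex.I * (y : ℂ) ≠ 0 := by simp [hy]
  exact (h.cexp.div_const (Complex.I * (y : ℂ))).congr_deriv (mul_div_cancel_right₀ _ hne)

/-- Tail of an oscillatory integral with a symbol decaying like `1/t`. -/
lemma exists_tendsto_integral_phase_mul {H H' : ℝ → ℝ} {M y : ℝ} (hy : y ≠ 0)
    (hH : ∀ t, 0 < t → HasDerivAt H (H' t) t) (hc : ContinuousOn H' (Set.Ioi 0))
    (hM : ∀ t, 0 < t → |H t| ≤ M / t) (hM' : ∀ t, 0 < t → |H' t| ≤ M / t ^ 2) :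
    ∃ L : ℂ, ‖L‖ ≤ 2 * M ∧
      Tendsto (fun S => ∫ t in (|y|⁻¹)..S, phase y t * (H t : ℂ)) atTop (nhds L) := by
  have hy' : 0 < |y| := abs_pos.mpr hy
  set δ := |y|⁻¹ with hδ_def
  have hδ : 0 < δ := inv_pos.mpr hy'
  have hnorm : ‖Complex.I * (y : ℂ)‖ = |y| := by simp
  have hsub : Set.Ioi δ ⊆ Set.Ioi (0 : ℝ) := Set.Ioi_subset_Ioi hδ.le
  have hrpow : ∀ t ∈ Set.Ioi δ, M * t ^ (-2 : ℝ) = M / t ^ 2 := fun t ht => by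
    rw [Real.rpow_neg (hδ.trans ht).le, div_eq_mul_inv]; norm_cast
  have hdom : IntegrableOn (fun t : ℝ => M * t ^ (-2 : ℝ)) (Set.Ioi δ) :=
    (integrableOn_Ioi_rpow_of_lt (by norm_num) hδ).const_mul M
  have hcont : ContinuousOn (fun t => phase y t / (Complex.I * y) * (H' t : ℂ)) (Set.Ioi 0) :=
    ((continuous_phase y).div_const _).continuousOn.mul
      (Complex.continuous_ofReal.comp_continuousOn hc)
  have hbound : ∀ t ∈ Set.Ioi δ, ‖phase y t / (Complex.I * y) * (H' t : ℂ)‖ ≤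
      |y|⁻¹ * (M * t ^ (-2 : ℝ)) := fun t ht => by
    rw [norm_mul, norm_div, hnorm, norm_phase, one_div, Complex.norm_real, hrpow t ht]
    exact mul_le_mul_of_nonneg_left (hM' t (hsub ht)) (by positivity)
  have hint : IntegrableOn (fun t => phase y t / (Complex.I * y) * (H' t : ℂ)) (Set.Ioi δ) :=
    (hdom.const_mul _).mono' ((hcont.mono hsub).aestronglyMeasurable measurableSet_Ioi)
      ((ae_restrict_iff' measurableSet_Ioi).mpr (Eventually.of_forall hbound))
  have hparts : ∀ S, δ ≤ S → ∫ t in δ..S, phase y t * (H t : ℂ) =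
      phase y S / (Complex.I * y) * H S - phase y δ / (Complex.I * y) * H δ -
        ∫ t in δ..S, phase y t / (Complex.I * y) * (H' t : ℂ) := fun S hS => by
    have hpos : Set.uIcc δ S ⊆ Set.Ioi 0 := fun t ht => by
      rw [Set.uIcc_of_le hS] at ht; exact hδ.trans_le ht.1
    rw [intervalIntegral.integral_mul_deriv_eq_deriv_mul (u := fun t => phase y t / (Complex.I * y))
      (u' := phase y) (v := fun t => (H t : ℂ)) (v' := fun t => (H' t : ℂ))
      (fun t _ => hasDerivAt_phase_div hy t) (fun t ht => (hH t (hpos ht)).ofReal_comp)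
      ((continuous_phase y).intervalIntegrable _ _)
      (Complex.continuous_ofReal.comp_continuousOn (hc.mono hpos)).intervalIntegrable]
    ring
  have hzero : Tendsto (fun S => phase y S / (Complex.I * y) * (H S : ℂ)) atTop (nhds 0) := by
    have h0 : Tendsto (fun S : ℝ => |y|⁻¹ * (M / S)) atTop (nhds 0) := by
      simpa using (tendsto_const_nhds.div_atTop tendsto_id).const_mul (|y|⁻¹)
    refine squeeze_zero_norm' ?_ h0
    filter_upwards [eventually_gt_atTop 0] with S hS
    rw [norm_mul, norm_div, hnorm, norm_phase, one_div, Complex.norm_real]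
    exact mul_le_mul_of_nonneg_left (hM S hS) (by positivity)
  have hlim := intervalIntegral_tendsto_integral_Ioi δ hint tendsto_id
  refine ⟨0 - phase y δ / (Complex.I * y) * H δ -
    ∫ t in Set.Ioi δ, phase y t / (Complex.I * y) * (H' t : ℂ), ?_, ?_⟩
  · have h1 : ‖phase y δ / (Complex.I * y) * H δ‖ ≤ M := by
      rw [norm_mul, norm_div, hnorm, norm_phase, one_div, Complex.norm_real]
      calc |y|⁻¹ * ‖H δ‖ ≤ δ * (M / δ) := mul_le_mul_of_nonneg_left (hM δ hδ) hδ.le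
        _ = M := mul_div_cancel₀ _ hδ.ne'
    have h2 : ‖∫ t in Set.Ioi δ, phase y t / (Complex.I * y) * (H' t : ℂ)‖ ≤ M := by
      refine (norm_integral_le_of_norm_le (hdom.const_mul (|y|⁻¹))
        ((ae_restrict_iff' measurableSet_Ioi).mpr (Eventually.of_forall hbound))).trans ?_
      rw [integral_const_mul, integral_const_mul, integral_Ioi_rpow_of_lt (by norm_num) hδ]
      norm_num
      rw [Real.rpow_neg_one, ← hδ_def]
      field_simp
      exact le_rfl
    calc _ ≤ ‖(0 : ℂ) - phase y δ / (Complex.I * y) * H δ‖ + _ := norm_sub_le _ _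
      _ ≤ M + M := by rw [zero_sub, norm_neg]; exact add_le_add h1 h2
      _ = 2 * M := by ring
  · refine ((hzero.sub_const _).sub hlim).congr' ?_
    filter_upwards [eventually_ge_atTop δ] with S hS
    exact (hparts S hS).symm

lemma continuousOn_phase_mul_shiftedKernel (y a : ℝ) :
    ContinuousOn (fun t => phase y t * (shiftedKernel a t : ℂ)) (Set.Ioi 0) :=
  (continuous_phase y).continuousOn.mul
    (Complex.continuous_ofReal.comp_continuousOn (continuousOn_shiftedKernel a))

lemma intervalIntegrable_phase_mul_shiftedKernel (y a : ℝ) {s t : ℝ} (hs : 0 < s) (ht : 0 < t) :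
    IntervalIntegrable (fun t => phase y t * (shiftedKernel a t : ℂ)) volume s t :=
  ((continuousOn_phase_mul_shiftedKernel y a).mono fun _ hx =>
    (lt_min hs ht).trans_le hx.1).intervalIntegrable

lemma pvInt_eq (y a : ℝ) {ε R : ℝ} (hε : 0 < ε) (hR : |a| + ε ≤ R) :
    pvInt (a * (a ^ 2 + 1)) y a ε R = phase y a *
      ((∫ t in ε..(R - a), phase y t * (shiftedKernel a t : ℂ)) -
        ∫ t in ε..(R + a), phase (-y) t * (shiftedKernel (-a) t : ℂ)) := by
  obtain ⟨ha1, ha2⟩ := abs_le.mp (show |a| ≤ R - ε by linarith)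
  set Φ : ℝ → ℂ := fun ξ => phase y ξ *
    (((ξ ^ 2 + 1 : ℝ) : ℂ) / ((a * (a ^ 2 + 1) - ξ * (ξ ^ 2 + 1) : ℝ) : ℂ)) with hΦ
  have hplus : ∀ t, Φ (a + t) = phase y a * (phase y t * (shiftedKernel a t : ℂ)) := fun t => by
    rw [← mul_assoc, ← phase_add]
    simp only [hΦ]
    rw [← Complex.ofReal_div, shiftedKernel]
    congr 3
    ring
  have hminus : ∀ t, Φ (a - t) =
      phase y a * -(phase (-y) t * (shiftedKernel (-a) t : ℂ)) := fun t => by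
    rw [← phase_neg_right, ← mul_neg, ← mul_assoc, ← phase_add]
    simp only [hΦ]
    rw [← Complex.ofReal_div, ← Complex.ofReal_neg, shiftedKernel, ← div_neg, ← sub_eq_add_neg]
    congr 3 <;> ring
  have hcont : ∀ s : Set ℝ, a ∉ s → ContinuousOn Φ s := fun s hs => by
    refine (continuous_phase y).continuousOn.mul (ContinuousOn.div (by fun_prop) (by fun_prop) ?_)
    intro ξ hξ h0
    have h0' : (a - ξ) * (ξ ^ 2 + a * ξ + a ^ 2 + 1) = 0 := by
      rw [← Complex.ofReal_eq_zero.mp h0]; ring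
    rcases mul_eq_zero.mp h0' with h | h
    · exact hs (by rwa [sub_eq_zero.mp h])
    · nlinarith [sq_nonneg (ξ + a), sq_nonneg a, sq_nonneg ξ]
  have hset : {ξ : ℝ | ε ≤ |ξ - a| ∧ |ξ| ≤ R} =
      Set.Icc (-R) (a - ε) ∪ Set.Icc (a + ε) R := by
    ext ξ
    simp only [Set.mem_ofPred_eq, Set.mem_union, Set.mem_Icc, le_abs, abs_le]
    constructor
    · rintro ⟨h | h, h1, h2⟩
      · right; constructor <;> linarith
      · left; constructor <;> linarith
    · rintro (⟨h1, h2⟩ | ⟨h1, h2⟩)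
      · exact ⟨Or.inr (by linarith), by linarith, by linarith⟩
      · exact ⟨Or.inl (by linarith), by linarith, by linarith⟩
  have hdisj : Disjoint (Set.Icc (-R) (a - ε)) (Set.Icc (a + ε) R) := by
    rw [Set.disjoint_left]
    rintro ξ ⟨_, h2⟩ ⟨h3, _⟩
    linarith
  change ∫ ξ in {ξ : ℝ | ε ≤ |ξ - a| ∧ |ξ| ≤ R}, Φ ξ = _
  rw [hset, setIntegral_union hdisj measurableSet_Icc
    (hcont _ fun h => by linarith [h.2]).integrableOn_Icc
    (hcont _ fun h => by linarith [h.1]).integrableOn_Icc,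
    integral_Icc_eq_integral_Ioc, integral_Icc_eq_integral_Ioc,
    ← intervalIntegral.integral_of_le (by linarith),
    ← intervalIntegral.integral_of_le (by linarith)]
  have e1 : ∫ ξ in (a + ε)..R, Φ ξ = ∫ t in ε..(R - a), Φ (a + t) := by
    rw [intervalIntegral.integral_comp_add_left Φ a]; congr 1; ring
  have e2 : ∫ ξ in (-R)..(a - ε), Φ ξ = ∫ t in ε..(R + a), Φ (a - t) := by
    rw [intervalIntegral.integral_comp_sub_left Φ a]; congr 1; ring
  rw [e1, e2]
  simp_rw [hplus, hminus]
  rw [intervalIntegral.integral_const_mul, intervalIntegral.integral_const_mul,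
    intervalIntegral.integral_neg]
  ring

lemma norm_phase_mul_shiftedKernel_sub_le (y a : ℝ) {t : ℝ} (ht : 0 < t) :
    ‖phase y t * (shiftedKernel a t : ℂ) - phase (-y) t * (shiftedKernel (-a) t : ℂ)‖ ≤
      216 * (√(a ^ 2 + 1) / (√(a ^ 2 + 1) ^ 2 + t ^ 2)) + 600 * |y| := by
  calc _ = ‖phase y t * ((shiftedKernel a t - shiftedKernel (-a) t : ℝ) : ℂ) +
        (phase y t - phase (-y) t) * (shiftedKernel (-a) t : ℂ)‖ := by
        congr 1; push_cast; ring
    _ ≤ |shiftedKernel a t - shiftedKernel (-a) t| +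
        ‖phase y t - phase (-y) t‖ * |shiftedKernel (-a) t| := by
        refine (norm_add_le _ _).trans_eq ?_
        rw [norm_mul, norm_mul, norm_phase, one_mul, Complex.norm_real, Complex.norm_real,
          Real.norm_eq_abs, Real.norm_eq_abs]
    _ ≤ 216 * (√(a ^ 2 + 1) / (√(a ^ 2 + 1) ^ 2 + t ^ 2)) + 2 * |y * t| * (300 / t) := by
        gcongr
        · exact abs_shiftedKernel_sub_le a ht
        · exact norm_phase_sub_phase_neg_le y t
        · exact abs_shiftedKernel_le (-a) ht
    _ = _ := by
        rw [abs_mul, abs_of_pos ht]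
        field_simp
        ring

lemma integral_div_sq_add_sq_le {b δ : ℝ} (hb : 0 < b) :
    ∫ t in (0 : ℝ)..δ, b / (b ^ 2 + t ^ 2) ≤ 2 := by
  have hd : ∀ t : ℝ, HasDerivAt (fun t => Real.arctan (t / b)) (b / (b ^ 2 + t ^ 2)) t :=
    fun t => by
      refine ((hasDerivAt_id' t).div_const b).arctan.congr_deriv ?_
      field_simp
  have hc : Continuous fun t : ℝ => b / (b ^ 2 + t ^ 2) :=
    continuous_const.div (by fun_prop) fun t => by positivity
  rw [intervalIntegral.integral_eq_sub_of_hasDerivAt (fun t _ => hd t)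
    (hc.intervalIntegrable _ _), zero_div, Real.arctan_zero, sub_zero]
  linarith [Real.arctan_lt_pi_div_two (δ / b), Real.pi_lt_four]

/-- Uniform boundedness of the principal-value kernel: there is C > 0 such that for every c,
every y ≠ 0 and a the real root of ξ(ξ²+1) = c, the iterated limit
K(c,y) = lim_{ε→0⁺} lim_{R→∞} pvInt exists and |K(c,y)| ≤ C. -/
theorem pv_kernel_bounded :
    ∃ C : ℝ, 0 < C ∧ ∀ c y : ℝ, y ≠ 0 → ∀ a : ℝ, a * (a ^ 2 + 1) = c →
      ∃ K : ℂ, ‖K‖ ≤ C ∧ ∃ g : ℝ → ℂ,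
        (∀ ε : ℝ, 0 < ε → Tendsto (fun R => pvInt c y a ε R) atTop (nhds (g ε))) ∧
        Tendsto g (nhdsWithin 0 (Set.Ioi 0)) (nhds K) := by
  refine ⟨3000, by norm_num, ?_⟩
  rintro _ y hy a rfl
  have hy' : 0 < |y| := abs_pos.mpr hy
  obtain ⟨L₁, hL₁, hlim₁⟩ := exists_tendsto_integral_phase_mul hy
    (fun t => hasDerivAt_shiftedKernel a) (continuousOn_shiftedKernelDeriv a)
    (fun t => abs_shiftedKernel_le a) (fun t => abs_shiftedKernelDeriv_le a)
  obtain ⟨L₂, hL₂, hlim₂⟩ := exists_tendsto_integral_phase_mul (neg_ne_zero.mpr hy)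
    (fun t => hasDerivAt_shiftedKernel (-a)) (continuousOn_shiftedKernelDeriv (-a))
    (fun t => abs_shiftedKernel_le (-a)) (fun t => abs_shiftedKernelDeriv_le (-a))
  rw [abs_neg] at hlim₂
  set δ := |y|⁻¹ with hδ_def
  have hδ : 0 < δ := inv_pos.mpr hy'
  set b := √(a ^ 2 + 1) with hb_def
  have hb : 0 < b := Real.sqrt_pos.mpr (by positivity)
  set F : ℝ → ℂ := fun t => phase y t * (shiftedKernel a t : ℂ) -
    phase (-y) t * (shiftedKernel (-a) t : ℂ) with hF
  have hFc : ContinuousOn F (Set.Ioi 0) :=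
    (continuousOn_phase_mul_shiftedKernel y a).sub (continuousOn_phase_mul_shiftedKernel (-y) (-a))
  have hc : Continuous fun t : ℝ => b / (b ^ 2 + t ^ 2) :=
    continuous_const.div (by fun_prop) fun t => by positivity
  have hdom : IntervalIntegrable (fun t => 216 * (b / (b ^ 2 + t ^ 2)) + 600 * |y|) volume 0 δ :=
    ((continuous_const.mul hc).add continuous_const).intervalIntegrable _ _
  have hbound : ∀ t ∈ Set.Ioc 0 δ, ‖F t‖ ≤ 216 * (b / (b ^ 2 + t ^ 2)) + 600 * |y| :=
    fun t ht => norm_phase_mul_shiftedKernel_sub_le y a ht.1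
  have hFi : IntervalIntegrable F volume 0 δ := by
    rw [intervalIntegrable_iff_integrableOn_Ioc_of_le hδ.le] at hdom ⊢
    exact hdom.mono' ((hFc.mono fun t ht => ht.1).aestronglyMeasurable measurableSet_Ioc)
      ((ae_restrict_iff' measurableSet_Ioc).mpr (Eventually.of_forall hbound))
  have hFnorm : ‖∫ t in (0 : ℝ)..δ, F t‖ ≤ 1032 := by
    refine (intervalIntegral.norm_integral_le_of_norm_le hδ.le
      (Eventually.of_forall hbound) hdom).trans ?_
    rw [intervalIntegral.integral_add ((hc.intervalIntegrable _ _).const_mul 216)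
      (continuous_const.intervalIntegrable _ _), intervalIntegral.integral_const_mul,
      intervalIntegral.integral_const, sub_zero, smul_eq_mul]
    have h1 := integral_div_sq_add_sq_le (δ := δ) hb
    have h2 : δ * (600 * |y|) = 600 := by rw [hδ_def]; field_simp
    linarith
  refine ⟨phase y a * ((∫ t in (0 : ℝ)..δ, F t) + (L₁ - L₂)), ?_,
    fun ε => phase y a * ((∫ t in ε..δ, F t) + (L₁ - L₂)), fun ε hε => ?_, ?_⟩
  · rw [norm_mul, norm_phase, one_mul]
    linarith [norm_add_le (∫ t in (0 : ℝ)..δ, F t) (L₁ - L₂), norm_sub_le L₁ L₂]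
  · have hR₁ : Tendsto (fun R : ℝ => R - a) atTop atTop :=
      tendsto_atTop_add_const_right _ _ tendsto_id
    have hR₂ : Tendsto (fun R : ℝ => R + a) atTop atTop :=
      tendsto_atTop_add_const_right _ _ tendsto_id
    refine (((hlim₁.comp hR₁).sub (hlim₂.comp hR₂)).const_add
      (∫ t in ε..δ, F t) |>.const_mul (phase y a)).congr' ?_
    filter_upwards [eventually_ge_atTop (|a| + ε)] with R hR
    obtain ⟨ha1, ha2⟩ := abs_le.mp (show |a| ≤ R - ε by linarith)
    have hp₁ : 0 < R - a := by linarith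
    have hp₂ : 0 < R + a := by linarith
    rw [pvInt_eq y a hε hR,
      ← intervalIntegral.integral_add_adjacent_intervals
        (intervalIntegrable_phase_mul_shiftedKernel y a hε hδ)
        (intervalIntegrable_phase_mul_shiftedKernel y a hδ hp₁),
      ← intervalIntegral.integral_add_adjacent_intervals
        (intervalIntegrable_phase_mul_shiftedKernel (-y) (-a) hε hδ)
        (intervalIntegrable_phase_mul_shiftedKernel (-y) (-a) hδ hp₂), hF,
      intervalIntegral.integral_sub (intervalIntegrable_phase_mul_shiftedKernel y a hε hδ)
        (intervalIntegrable_phase_mul_shiftedKernel (-y) (-a) hε hδ)]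
    simp only [Function.comp_apply]
    ring
  · refine Tendsto.const_mul _ (Tendsto.add_const _ ?_)
    have h0 : Tendsto (fun ε => ∫ t in δ..ε, F t) (nhdsWithin 0 (Set.Ioi 0))
        (nhds (∫ t in δ..0, F t)) := by
      refine (intervalIntegral.continuousOn_primitive_interval' hFi Set.right_mem_uIcc 0
        Set.left_mem_uIcc).mono_left ?_
      rw [Set.uIcc_of_le hδ.le, ← nhdsWithin_Ioc_eq_nhdsGT hδ]
      exact nhdsWithin_mono _ Set.Ioc_subset_Icc_self
    simpa only [intervalIntegral.integral_symm δ] using h0.neg
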